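/- Let ξ ∈ ℝ. For any x, y, z ∈ ℝ⁴, setting w = Ξ(x,y,z), one has Ξ(x,z,w) = det(C(w,x), C(x,w)) · z = det(C(z,x), C(z,y)) · det(C(x,y), C(x,z))² · det(C(x,z), C(z,x)) · z. Moreover, Ξ(x,y,z) = −det(E(x,z,y), C(z,x)) x − det(C(x,z), C(z,x)) y + det(C(x,y), C(z,x)) z. -/

import Mathlib

noncomputable section

/-- x⁻ = (x₀,x₁,x₂). -/
def vm (x : Fin 4 → ℝ) : Fin 3 → ℝ := ![x 0, x 1, x 2]

/-- x⁺ = (x₁,x₂,x₃). -/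
def vp (x : Fin 4 → ℝ) : Fin 3 → ℝ := ![x 1, x 2, x 3]

/-- Determinant of the 3×3 matrix with rows a, b, c. -/
def det3 (a b c : Fin 3 → ℝ) : ℝ := Matrix.det (Matrix.of ![a, b, c])

/-- Determinant of the 2×2 matrix with rows a, b. -/
def det2 (a b : Fin 2 → ℝ) : ℝ := Matrix.det (Matrix.of ![a, b])

/-- The map C(x,y) = (det(x⁻,x⁺,y⁻), det(x⁻,x⁺,y⁺)). -/
def Cmap (x y : Fin 4 → ℝ) : Fin 2 → ℝ :=
  ![det3 (vm x) (vp x) (vm y), det3 (vm x) (vp x) (vp y)]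

/-- The trilinear map E. -/
def Emap (w x y : Fin 4 → ℝ) : Fin 2 → ℝ :=
  ![det3 (vm w) (vp x) (vm y) - det3 (vp w) (vm x) (vm y),
    det3 (vm w) (vp x) (vp y) - det3 (vp w) (vm x) (vp y)]

/-- Ψ₋(x,y,z) = C(y,z)⁻x + E(y,z,x)⁻y − C(y,x)⁻z. -/
def PsiM (x y z : Fin 4 → ℝ) : Fin 4 → ℝ :=
  Cmap y z 0 • x + Emap y z x 0 • y - Cmap y x 0 • z

/-- Ψ₊(x,y,z) = C(y,z)⁺x + E(y,z,x)⁺y − C(y,x)⁺z. -/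
def PsiP (x y z : Fin 4 → ℝ) : Fin 4 → ℝ :=
  Cmap y z 1 • x + Emap y z x 1 • y - Cmap y x 1 • z

/-- Ξ(x,y,z) = C(z,x)⁻ Ψ₊(y,x,z) − C(z,x)⁺ Ψ₋(y,x,z). -/
def Xi (x y z : Fin 4 → ℝ) : Fin 4 → ℝ :=
  Cmap z x 0 • PsiP y x z - Cmap z x 1 • PsiM y x z

theorem det2_eq (u v : Fin 2 → ℝ) : det2 u v = u 0 * v 1 - u 1 * v 0 := by
  simp [det2, Matrix.det_fin_two]

theorem det3_eq (a b c : Fin 3 → ℝ) :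
    det3 a b c = a 0 * (b 1 * c 2 - b 2 * c 1) - a 1 * (b 0 * c 2 - b 2 * c 0)
      + a 2 * (b 0 * c 1 - b 1 * c 0) := by
  simp [det3, Matrix.det_fin_three]
  ring

theorem det2_smul_right (r : ℝ) (u v : Fin 2 → ℝ) : det2 u (r • v) = r * det2 u v := by
  simp only [det2_eq, Pi.smul_apply, smul_eq_mul]
  ring

theorem det2_smul_left (r : ℝ) (u v : Fin 2 → ℝ) : det2 (r • u) v = r * det2 u v := by
  simp only [det2_eq, Pi.smul_apply, smul_eq_mul]
  ring

theorem det2_self (u : Fin 2 → ℝ) : det2 u u = 0 := by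
  rw [det2_eq]
  ring

theorem det2_swap (u v : Fin 2 → ℝ) : det2 u v = -det2 v u := by
  simp only [det2_eq]
  ring

theorem Emap_comm (w x y : Fin 4 → ℝ) : Emap w x y = Emap x w y := by
  ext i
  fin_cases i <;> simp [Emap, det3_eq, vm, vp] <;> ring

/-- The cyclic sum of `Emap` vanishes. -/
theorem Emap_cyclic (x y z : Fin 4 → ℝ) : Emap x y z + Emap y z x + Emap x z y = 0 := by
  ext i
  fin_cases i <;> simp [Emap, det3_eq, vm, vp] <;> ring

theorem Cmap_combination_right (a b c : ℝ) (x y z : Fin 4 → ℝ) :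
    Cmap x (a • x + b • y + c • z) = b • Cmap x y + c • Cmap x z := by
  ext i
  fin_cases i <;> simp [Cmap, det3_eq, vm, vp] <;> ring

theorem Cmap_combination_left (a b c : ℝ) (x y z : Fin 4 → ℝ) :
    Cmap (a • x + b • y + c • z) x =
      b ^ 2 • Cmap y x + c ^ 2 • Cmap z x + (b * c) • Emap y z x
        - a • (b • Cmap x y + c • Cmap x z) := by
  ext i
  fin_cases i <;> simp [Cmap, Emap, det3_eq, vm, vp] <;> ring

theorem Emap_combination (a b c : ℝ) (x y z : Fin 4 → ℝ) :
    Emap x (a • x + b • y + c • z) z =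
      (2 * a) • Cmap x z + b • Emap x y z - c • Cmap z x := by
  ext i
  fin_cases i <;> simp [Cmap, Emap, det3_eq, vm, vp] <;> ring

theorem det2_Emap_Cmap (x y z : Fin 4 → ℝ) :
    det2 (Emap x y z) (Cmap x z) = det2 (Cmap x y) (Cmap z x) := by
  simp [det2_eq, Cmap, Emap, det3_eq, vm, vp]
  ring

theorem det2_Cmap_Cmap (x y z : Fin 4 → ℝ) :
    det2 (Cmap y x) (Cmap z x) = -det2 (Cmap x y) (Cmap z y) := by
  simp [det2_eq, Cmap, det3_eq, vm, vp]
  ring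

theorem Xi_eq (x y z : Fin 4 → ℝ) :
    Xi x y z = -(det2 (Emap x z y) (Cmap z x)) • x - det2 (Cmap x z) (Cmap z x) • y
      + det2 (Cmap x y) (Cmap z x) • z := by
  ext i
  simp only [Xi, PsiP, PsiM, det2_eq, Pi.add_apply, Pi.sub_apply, Pi.smul_apply, smul_eq_mul]
  ring

theorem Xi_eq_combination (x y z : Fin 4 → ℝ) :
    Xi x y z = (-det2 (Emap x z y) (Cmap z x)) • x + (-det2 (Cmap x z) (Cmap z x)) • y
      + det2 (Cmap x y) (Cmap z x) • z := by
  rw [Xi_eq, neg_smul (det2 (Cmap x z) (Cmap z x)), sub_eq_add_neg]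

theorem Cmap_Xi_right (x y z : Fin 4 → ℝ) :
    Cmap x (Xi x y z) = det2 (Cmap x y) (Cmap x z) • Cmap z x := by
  rw [Xi_eq_combination, Cmap_combination_right]
  ext i
  simp only [det2_eq, Pi.add_apply, Pi.smul_apply, smul_eq_mul]
  fin_cases i <;> simp only [Fin.zero_eta, Fin.mk_one] <;> ring

theorem Cmap_Xi_left (x y z : Fin 4 → ℝ) :
    Cmap (Xi x y z) x =
      (det2 (Cmap x y) (Cmap x z) * det2 (Cmap z x) (Cmap z y)) • Cmap x z := by
  rw [Xi_eq_combination, Cmap_combination_left]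
  have hzyx := det2_Emap_Cmap z y x
  rw [Emap_comm z y x] at hzyx
  have hxzy := det2_Emap_Cmap x z y
  have hxyz := det2_Emap_Cmap x y z
  have hC := det2_Cmap_Cmap x y z
  have hE := Emap_cyclic x y z
  have hE₀ := congrFun hE 0
  have hE₁ := congrFun hE 1
  simp only [Pi.add_apply, Pi.zero_apply] at hE₀ hE₁
  generalize Cmap x z = q at *
  generalize Cmap z x = p at *
  generalize Cmap x y = u at *
  generalize Cmap y x = v at *
  generalize Cmap z y = t at *
  generalize Emap y z x = e at *
  generalize Emap x z y = g at *
  generalize Emap x y z = f at *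
  ext i
  simp only [Pi.add_apply, Pi.sub_apply, Pi.smul_apply, smul_eq_mul]
  simp only [det2_eq] at *
  fin_cases i <;> simp only [Fin.zero_eta, Fin.mk_one]
  · linear_combination
      q 0 * ((q 0 * p 1 - q 1 * p 0) * hC - (u 0 * p 1 - u 1 * p 0) * hzyx)
      + p 0 * (-(q 0 * p 1 - q 1 * p 0) * hxzy
        + (u 0 * p 1 - u 1 * p 0) * (hE₀ * q 1 - hE₁ * q 0 - hxyz))
  · linear_combination
      q 1 * ((q 0 * p 1 - q 1 * p 0) * hC - (u 0 * p 1 - u 1 * p 0) * hzyx)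
      + p 1 * (-(q 0 * p 1 - q 1 * p 0) * hxzy
        + (u 0 * p 1 - u 1 * p 0) * (hE₀ * q 1 - hE₁ * q 0 - hxyz))

theorem det2_Emap_Xi_Cmap (x y z : Fin 4 → ℝ) :
    det2 (Emap x (Xi x y z) z) (Cmap x z) = 0 := by
  rw [Xi_eq_combination, Emap_combination]
  have hxyz := det2_Emap_Cmap x y z
  simp only [det2_eq, Pi.add_apply, Pi.sub_apply, Pi.smul_apply, smul_eq_mul] at *
  linear_combination -(Cmap x z 0 * Cmap z x 1 - Cmap x z 1 * Cmap z x 0) * hxyz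

theorem Xi_Xi (x y z : Fin 4 → ℝ) :
    Xi x z (Xi x y z) = det2 (Cmap (Xi x y z) x) (Cmap x (Xi x y z)) • z := by
  have hE : det2 (Emap x (Xi x y z) z) (Cmap (Xi x y z) x) = 0 := by
    rw [Cmap_Xi_left, det2_smul_right, det2_Emap_Xi_Cmap, mul_zero]
  have hC : det2 (Cmap x z) (Cmap (Xi x y z) x) = 0 := by
    rw [Cmap_Xi_left, det2_smul_right, det2_self, mul_zero]
  rw [Xi_eq x z, hE, hC, det2_swap (Cmap x (Xi x y z))]
  simp

theorem statement19 (ξ : ℝ) (x y z : Fin 4 → ℝ) :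
    Xi x z (Xi x y z) = det2 (Cmap (Xi x y z) x) (Cmap x (Xi x y z)) • z ∧
    Xi x z (Xi x y z)
      = (det2 (Cmap z x) (Cmap z y) * det2 (Cmap x y) (Cmap x z) ^ 2 *
          det2 (Cmap x z) (Cmap z x)) • z ∧
    Xi x y z
      = -(det2 (Emap x z y) (Cmap z x)) • x
        - det2 (Cmap x z) (Cmap z x) • y
        + det2 (Cmap x y) (Cmap z x) • z := by
  refine ⟨Xi_Xi x y z, ?_, Xi_eq x y z⟩
  rw [Xi_Xi, Cmap_Xi_left, Cmap_Xi_right, det2_smul_left, det2_smul_right]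
  congr 1
  ring
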